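/- arXiv:2304.13432 — 2 statements merged into one kernel-verified Lean document; each statement's English description precedes it below -/
import Mathlib

section
/- Let π be a permutation of F_2^m such that there exists an (m−1)-dimensional subspace S of F_2^m with D_a D_b π identically zero for all a, b ∈ S. Define f : F_2^m × F_2^m → F_2 by f(x,y) = x·π(y). Then f has at least two distinct m-dimensional M-subspaces (in particular, besides the canonical M-subspace F_2^m × {0}, there is a second m-dimensional M-subspace of f). -/
open scoped BigOperators

/-- The vector space `F_2^n`. -/
abbrev BV (n : ℕ) := Fin n → ZMod 2

/-- Dot product on `F_2^n`. -/
def dotp {n : ℕ} (x y : BV n) : ZMod 2 := ∑ i, x i * y i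

/-- `W` is an M-subspace of `f` : all second-order derivatives of `f` in directions
from `W` vanish identically. -/
def IsMSub {M : Type} [AddCommGroup M] [Module (ZMod 2) M] (f : M → ZMod 2)
    (W : Submodule (ZMod 2) M) : Prop :=
  ∀ a ∈ W, ∀ b ∈ W, ∀ x, f x + f (x + a) + f (x + b) + f (x + a + b) = 0

theorem dotp_add_left {n : ℕ} (x y z : BV n) : dotp (x + y) z = dotp x z + dotp y z :=
  add_dotProduct x y z

theorem dotp_add_right {n : ℕ} (x y z : BV n) : dotp x (y + z) = dotp x y + dotp x z :=
  dotProduct_add x y z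

theorem exists_dotp_eq {n : ℕ} (φ : BV n →ₗ[ZMod 2] ZMod 2) : ∃ t : BV n, ∀ x, dotp t x = φ x := by
  obtain ⟨t, ht⟩ := (dotProductEquiv (ZMod 2) (Fin n)).surjective φ
  exact ⟨t, fun x => by rw [← ht]; rfl⟩

theorem finrank_prod_submodule {m : ℕ} (A B : Submodule (ZMod 2) (BV m)) :
    Module.finrank (ZMod 2) ↥(A.prod B) =
      Module.finrank (ZMod 2) ↥A + Module.finrank (ZMod 2) ↥B := by
  let e : ↥(A.prod B) ≃ₗ[ZMod 2] A × B :=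
    { toFun := fun p => (⟨p.1.1, p.2.1⟩, ⟨p.1.2, p.2.2⟩)
      invFun := fun p => ⟨(p.1, p.2), p.1.2, p.2.2⟩
      map_add' := fun _ _ => rfl
      map_smul' := fun _ _ => rfl }
  rw [e.finrank_eq, Module.finrank_prod]

/-- If the second-order derivatives of `π` vanish on `B` and every dot product of a vector of `A`
with `π` is `B`-periodic, then `A × B` is an M-subspace of `x · π y`. -/
theorem isMSub_prod {m : ℕ} {π : BV m → BV m} {f : BV m × BV m → ZMod 2}
    (hf : ∀ x y, f (x, y) = dotp x (π y)) {A B : Submodule (ZMod 2) (BV m)}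
    (hvan : ∀ a ∈ B, ∀ b ∈ B, ∀ x, π x + π (x + a) + π (x + b) + π (x + a + b) = 0)
    (hper : ∀ t ∈ A, ∀ a ∈ B, ∀ y, dotp t (π (y + a)) = dotp t (π y)) :
    IsMSub f (A.prod B) := by
  rintro ⟨u, a⟩ ⟨hu, ha⟩ ⟨v, b⟩ ⟨hv, hb⟩ ⟨x, y⟩
  have hx : dotp x (π y + π (y + a) + π (y + b) + π (y + a + b)) = 0 := by
    rw [hvan a ha b hb y]
    exact dotProduct_zero x
  simp only [dotp_add_right] at hx
  simp only [Prod.mk_add_mk, hf, dotp_add_left, hper u hu b hb, hper u hu a ha, hper v hv b hb,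
    hper v hv a ha]
  linear_combination hx + CharTwo.add_self_eq_zero (dotp u (π y)) +
    CharTwo.add_self_eq_zero (dotp v (π y))

/-- An injective map that is affine on a hyperplane `S` maps the cosets of `S` onto parallel
hyperplanes, whose common normal vector is `t`. -/
theorem exists_normal {m : ℕ} (hm : 1 ≤ m) {π : BV m → BV m} (hπ : Function.Injective π)
    {S : Submodule (ZMod 2) (BV m)} (hSdim : Module.finrank (ZMod 2) ↥S = m - 1)
    (hvan : ∀ a ∈ S, ∀ b ∈ S, ∀ x, π x + π (x + a) + π (x + b) + π (x + a + b) = 0) :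
    ∃ t : BV m, t ≠ 0 ∧ ∀ a ∈ S, ∀ y, dotp t (π (y + a)) = dotp t (π y) := by
  let L : S →ₗ[ZMod 2] BV m := AddMonoidHom.toZModLinearMap 2 <|
    AddMonoidHom.mk' (fun a : S => π a + π 0) fun a b => by
      have h := hvan a a.2 b b.2 0
      simp only [zero_add] at h
      rw [← sub_eq_zero, ZModModule.sub_eq_add, Submodule.coe_add]
      linear_combination h + ZModModule.add_self (π 0)
  have hL (a : S) : L a = π a + π 0 := rfl
  have hLinj : Function.Injective L := fun a b h =>
    Subtype.ext (hπ (add_right_cancel (by simpa only [hL] using h)))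
  have hrange : Module.finrank (ZMod 2) L.range = m - 1 := by
    rw [LinearMap.finrank_range_of_inj hLinj, hSdim]
  have hlt : L.range < ⊤ := by
    refine lt_top_iff_ne_top.2 fun h => ?_
    rw [h, finrank_top, Module.finrank_fin_fun] at hrange
    omega
  obtain ⟨φ, hφ, hle⟩ := Submodule.exists_le_ker_of_lt_top L.range hlt
  have hker : L.range = LinearMap.ker φ := by
    refine Submodule.eq_of_le_of_finrank_le hle ?_
    have h := Submodule.finrank_lt fun h => hφ (LinearMap.ker_eq_top.1 h)
    rw [Module.finrank_fin_fun] at h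
    omega
  have hmem (y : BV m) : φ (π y) = φ (π 0) ↔ y ∈ S := by
    rw [← sub_eq_zero, ← map_sub, ZModModule.sub_eq_add, ← LinearMap.mem_ker, ← hker]
    constructor
    · rintro ⟨a, ha⟩
      rw [← hπ (add_right_cancel (ha : π a + π 0 = _))]
      exact a.2
    · exact fun hy => ⟨⟨y, hy⟩, rfl⟩
  obtain ⟨t, ht⟩ := exists_dotp_eq φ
  refine ⟨t, ?_, fun a ha y => ?_⟩
  · rintro rfl
    exact hφ (LinearMap.ext fun x => (ht x).symm.trans (zero_dotProduct x))
  · rw [ht, ht]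
    have key : φ (π (y + a)) = φ (π 0) ↔ φ (π y) = φ (π 0) := by
      rw [hmem, hmem, S.add_mem_iff_left ha]
    have two : ∀ p q c : ZMod 2, (p = c ↔ q = c) → p = q := by decide
    exact two _ _ _ key

theorem stmt2 {m : ℕ} (hm : 1 ≤ m) (π : BV m → BV m) (hπ : Function.Bijective π)
    (S : Submodule (ZMod 2) (BV m)) (hSdim : Module.finrank (ZMod 2) ↥S = m - 1)
    (hvan : ∀ a ∈ S, ∀ b ∈ S, ∀ x, π x + π (x + a) + π (x + b) + π (x + a + b) = 0)
    (f : BV m × BV m → ZMod 2) (hf : ∀ x y, f (x, y) = dotp x (π y))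
    (U : Submodule (ZMod 2) (BV m × BV m))
    (hU : U = (⊤ : Submodule (ZMod 2) (BV m)).prod (⊥ : Submodule (ZMod 2) (BV m))) :
    IsMSub f U ∧ Module.finrank (ZMod 2) ↥U = m ∧
      ∃ W : Submodule (ZMod 2) (BV m × BV m),
        IsMSub f W ∧ Module.finrank (ZMod 2) ↥W = m ∧ W ≠ U := by
  have hfin (n : ℕ) : Module.finrank (ZMod 2) (BV n) = n := Module.finrank_fin_fun _
  subst hU
  refine ⟨isMSub_prod hf ?_ ?_, ?_, ?_⟩
  · rintro a rfl b rfl x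
    simp only [add_zero, ZModModule.add_self, zero_add]
  · rintro t - a rfl y
    rw [add_zero]
  · rw [finrank_prod_submodule, finrank_top, finrank_bot, hfin, add_zero]
  have hne {A B : Submodule (ZMod 2) (BV m)} (hB : Module.finrank (ZMod 2) B ≠ 0) :
      A.prod B ≠ (⊤ : Submodule (ZMod 2) (BV m)).prod ⊥ := by
    intro h
    refine hB ?_
    have hbot : B = ⊥ := by
      refine (Submodule.eq_bot_iff B).2 fun b hb => ?_
      have hmem : ((0, b) : BV m × BV m) ∈ A.prod B := ⟨A.zero_mem, hb⟩
      rw [h] at hmem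
      exact hmem.2
    rw [hbot, finrank_bot]
  obtain rfl | hm1 := hm.eq_or_lt
  · refine ⟨(⊥ : Submodule (ZMod 2) (BV 1)).prod ⊤, isMSub_prod hf ?_ ?_, ?_, hne ?_⟩
    · have htwo : ∀ a b : BV 1, a = 0 ∨ b = 0 ∨ a = b := by decide
      rintro a - b - x
      obtain rfl | rfl | rfl := htwo a b
      · simp only [add_zero, ZModModule.add_self, zero_add]
      · rw [add_zero, add_zero, add_assoc, ZModModule.add_self]
      · rw [add_assoc x, ZModModule.add_self, add_zero, add_assoc (π x), ZModModule.add_self,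
          add_zero, ZModModule.add_self]
    · rintro t rfl a - y
      exact (zero_dotProduct _).trans (zero_dotProduct _).symm
    · rw [finrank_prod_submodule, finrank_top, finrank_bot, hfin, zero_add]
    · rw [finrank_top, hfin]
      exact one_ne_zero
  · obtain ⟨t, ht, hper⟩ := exists_normal hm hπ.injective hSdim hvan
    refine ⟨(Submodule.span (ZMod 2) {t}).prod S, isMSub_prod hf hvan ?_, ?_, hne (by omega)⟩
    · intro u hu a ha y
      obtain ⟨c, rfl⟩ := Submodule.mem_span_singleton.1 hu
      exact (smul_dotProduct c t _).trans
        ((congrArg (c • ·) (hper a ha y)).trans (smul_dotProduct c t _).symm)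
    · rw [finrank_prod_submodule, finrank_span_singleton ht, hSdim]
      omega
end

section
/- Let n = 2m and let f1, f2, f3, f4 be Boolean functions in n variables (not necessarily bent) such that the concatenation f = f1||f2||f3||f4 is a bent function in n+2 variables. Assume there is no (m−1)-dimensional subspace V of F_2^n such that D_a D_b f_i = 0 for all a, b ∈ V and all i ∈ {1,2,3,4}. Then f has no (m+1)-dimensional M-subspace; equivalently, by Dillon's criterion, the bent function f lies outside the completed Maiorana–McFarland class MM^#. -/
open scoped BigOperators

/-- The bent 4-concatenation `f = f1 || f2 || f3 || f4`:
`f (x, y1, y2) = f1 x + y1 (f1 x + f3 x) + y2 (f1 x + f2 x)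
  + y1 y2 (f1 x + f2 x + f3 x + f4 x)`. -/
def concat {X : Type} (f1 f2 f3 f4 : X → ZMod 2) :
    X × (ZMod 2 × ZMod 2) → ZMod 2 :=
  fun p =>
    f1 p.1 + p.2.1 * (f1 p.1 + f3 p.1) + p.2.2 * (f1 p.1 + f2 p.1)
      + p.2.1 * p.2.2 * (f1 p.1 + f2 p.1 + f3 p.1 + f4 p.1)

/-- Walsh–Hadamard transform of `f : F_2^n → F_2` at `a`. -/
def walsh {n : ℕ} (f : BV n → ZMod 2) (a : BV n) : ℤ :=
  ∑ x : BV n, (-1 : ℤ) ^ (f x + dotp a x).val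

/-- Walsh–Hadamard transform of a function on `F_2^n × F_2 × F_2` at `a`. -/
def walshC {n : ℕ} (f : BV n × (ZMod 2 × ZMod 2) → ZMod 2)
    (a : BV n × (ZMod 2 × ZMod 2)) : ℤ :=
  ∑ p : BV n × (ZMod 2 × ZMod 2),
    (-1 : ℤ) ^ (f p + dotp a.1 p.1 + a.2.1 * p.2.1 + a.2.2 * p.2.2).val

theorem finrank_le_finrank_comap_inl_add {K E F : Type*} [Field K] [AddCommGroup E] [Module K E]
    [FiniteDimensional K E] [AddCommGroup F] [Module K F] [FiniteDimensional K F]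
    (W : Submodule K (E × F)) :
    Module.finrank K W ≤
      Module.finrank K (W.comap (LinearMap.inl K E F)) + Module.finrank K F := by
  have hinj : Function.Injective (LinearMap.inl K E F) := LinearMap.inl_injective
  have hmap := (Submodule.equivMapOfInjective _ hinj (W.comap (LinearMap.inl K E F))).finrank_eq
  have hrange := LinearMap.finrank_range_of_inj hinj
  have hdim := Submodule.finrank_sup_add_finrank_inf_eq W (LinearMap.range (LinearMap.inl K E F))
  have hle := Submodule.finrank_le (W ⊔ LinearMap.range (LinearMap.inl K E F))
  rw [Module.finrank_prod] at hle
  rw [Submodule.map_comap_eq, inf_comm] at hmap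
  omega

theorem exists_submodule_le_finrank_eq {K E : Type*} [Field K] [AddCommGroup E] [Module K E]
    {W : Submodule K E} {k : ℕ} (hk : k ≤ Module.finrank K W) :
    ∃ V ≤ W, Module.finrank K V = k := by
  obtain ⟨v, hv⟩ := exists_linearIndependent_of_le_finrank hk
  refine ⟨(Submodule.span K (Set.range v)).map W.subtype, W.map_subtype_le _, ?_⟩
  rw [Submodule.finrank_map_subtype_eq, finrank_span_eq_card hv, Fintype.card_fin]

theorem IsMSub.mono {M : Type} [AddCommGroup M] [Module (ZMod 2) M] {f : M → ZMod 2}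
    {V W : Submodule (ZMod 2) M} (hW : IsMSub f W) (hVW : V ≤ W) : IsMSub f V :=
  fun a ha b hb x => hW a (hVW ha) b (hVW hb) x

theorem IsMSub.comap_inl {E F : Type} [AddCommGroup E] [Module (ZMod 2) E] [AddCommGroup F]
    [Module (ZMod 2) F] {f : E × F → ZMod 2} {W : Submodule (ZMod 2) (E × F)}
    (hW : IsMSub f W) (y : F) :
    IsMSub (fun x => f (x, y)) (W.comap (LinearMap.inl (ZMod 2) E F)) := by
  intro a ha b hb x
  simpa using hW (a, 0) ha (b, 0) hb (x, y)

theorem concat_apply_zero_zero {X : Type} (f1 f2 f3 f4 : X → ZMod 2) (x : X) :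
    concat f1 f2 f3 f4 (x, 0, 0) = f1 x := by
  simp [concat]

theorem concat_apply_zero_one {X : Type} (f1 f2 f3 f4 : X → ZMod 2) (x : X) :
    concat f1 f2 f3 f4 (x, 0, 1) = f2 x := by
  simp [concat, ← add_assoc, CharTwo.add_self_eq_zero]

theorem concat_apply_one_zero {X : Type} (f1 f2 f3 f4 : X → ZMod 2) (x : X) :
    concat f1 f2 f3 f4 (x, 1, 0) = f3 x := by
  simp [concat, ← add_assoc, CharTwo.add_self_eq_zero]

theorem concat_apply_one_one {X : Type} (f1 f2 f3 f4 : X → ZMod 2) (x : X) :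
    concat f1 f2 f3 f4 (x, 1, 1) = f4 x := by
  simp only [concat, one_mul]
  generalize f1 x = a, f2 x = b, f3 x = c, f4 x = d
  revert a b c d
  decide

theorem stmt13 {n m : ℕ} (hnm : n = 2 * m)
    (f1 f2 f3 f4 : BV n → ZMod 2)
    (hbent : ∀ a, walshC (concat f1 f2 f3 f4) a = 2 ^ (m + 1) ∨
      walshC (concat f1 f2 f3 f4) a = -(2 ^ (m + 1)))
    (hnoV : ¬ ∃ V : Submodule (ZMod 2) (BV n),
      Module.finrank (ZMod 2) ↥V = m - 1 ∧
      IsMSub f1 V ∧ IsMSub f2 V ∧ IsMSub f3 V ∧ IsMSub f4 V) :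
    ¬ ∃ W : Submodule (ZMod 2) (BV n × (ZMod 2 × ZMod 2)),
      Module.finrank (ZMod 2) ↥W = m + 1 ∧ IsMSub (concat f1 f2 f3 f4) W := by
  rintro ⟨W, hdim, hW⟩
  have hle := finrank_le_finrank_comap_inl_add W
  have hplane : Module.finrank (ZMod 2) (ZMod 2 × ZMod 2) = 2 := by simp
  obtain ⟨V, hVW, hV⟩ := exists_submodule_le_finrank_eq
    (W := W.comap (LinearMap.inl (ZMod 2) (BV n) (ZMod 2 × ZMod 2))) (k := m - 1) (by omega)
  have hslice (y : ZMod 2 × ZMod 2) := (hW.comap_inl y).mono hVW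
  refine hnoV ⟨V, hV, ?_, ?_, ?_, ?_⟩
  · simpa only [concat_apply_zero_zero] using hslice (0, 0)
  · simpa only [concat_apply_zero_one] using hslice (0, 1)
  · simpa only [concat_apply_one_zero] using hslice (1, 0)
  · simpa only [concat_apply_one_one] using hslice (1, 1)
end
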